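/- Let d ≥ 1, let D ⊆ ℝ^d be any set, let s = (s_1,…,s_N) ∈ (ℝ^d)^N and ψ ∈ ℝ^N with ψ_i ≥ 0 for all i. Assume the separation property |s_i − s_j| ≥ √ψ_i + √ψ_j for all i ≠ j. Then for every i = 1, …, N the modified Laguerre cell is exactly the ball restricted to the domain: V_i(s,ψ) = closedBall(s_i, √ψ_i) ∩ closure(D). Moreover, if d = 2 and closedBall(s_i, √ψ_i) ⊆ closure(D), then vol(V_i(s,ψ)) = π ψ_i. -/

import Mathlib

open MeasureTheory

noncomputable section

/-- The Laguerre cell `Lag_i(s, ψ)` of the diagram of the domain `D` generated by the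
seed points `s` and weights `ψ`. -/
def Lag {d N : ℕ} (D : Set (EuclideanSpace ℝ (Fin d)))
    (s : Fin N → EuclideanSpace ℝ (Fin d)) (ψ : Fin N → ℝ) (i : Fin N) :
    Set (EuclideanSpace ℝ (Fin d)) :=
  {x | x ∈ closure D ∧ ∀ j : Fin N, j ≠ i → ‖x - s i‖ ^ 2 - ψ i ≤ ‖x - s j‖ ^ 2 - ψ j}

/-- The modified Laguerre cell `V_i(s, ψ)`: the Laguerre cell intersected with the
closed ball of center `s i` and radius `√(ψ i)`. -/
def Vcell {d N : ℕ} (D : Set (EuclideanSpace ℝ (Fin d)))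
    (s : Fin N → EuclideanSpace ℝ (Fin d)) (ψ : Fin N → ℝ) (i : Fin N) :
    Set (EuclideanSpace ℝ (Fin d)) :=
  Lag D s ψ i ∩ {x | ‖x - s i‖ ^ 2 ≤ ψ i}

/-- The void cell `V_0(s, ψ)`. -/
def Vvoid {d N : ℕ} (D : Set (EuclideanSpace ℝ (Fin d)))
    (s : Fin N → EuclideanSpace ℝ (Fin d)) (ψ : Fin N → ℝ) :
    Set (EuclideanSpace ℝ (Fin d)) :=
  {x | x ∈ closure D ∧ ∀ i : Fin N, 0 ≤ ‖x - s i‖ ^ 2 - ψ i}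

/-- The Kantorovich functional `K(s, ν, ψ)`. -/
def Kfun {d N : ℕ} (D : Set (EuclideanSpace ℝ (Fin d)))
    (s : Fin N → EuclideanSpace ℝ (Fin d)) (ν ψ : Fin N → ℝ) : ℝ :=
  (∑ i, ∫ x in Vcell D s ψ i, (‖x - s i‖ ^ 2 - ψ i)) + ∑ i, ν i * ψ i

/-- Under the separation property, each modified Laguerre cell is the closed ball of radius
`√ψ_i` around its seed intersected with `closure D`. -/
theorem Vcell_eq_closedBall_inter {d N : ℕ} (D : Set (EuclideanSpace ℝ (Fin d)))
    (s : Fin N → EuclideanSpace ℝ (Fin d)) (ψ : Fin N → ℝ) (hψ : ∀ i, 0 ≤ ψ i)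
    (hsep : ∀ i j : Fin N, i ≠ j → Real.sqrt (ψ i) + Real.sqrt (ψ j) ≤ ‖s i - s j‖)
    (i : Fin N) :
    Vcell D s ψ i = Metric.closedBall (s i) (Real.sqrt (ψ i)) ∩ closure D := by
  ext x
  simp only [Vcell, Lag, Set.mem_inter_iff, Set.mem_ofPred_eq, mem_closedBall_iff_norm]
  rw [Real.le_sqrt (norm_nonneg _) (hψ i)]
  refine ⟨fun h => ⟨h.2, h.1.1⟩, fun ⟨hx, hxD⟩ => ⟨⟨hxD, fun j hj => ?_⟩, hx⟩⟩
  have hxi : ‖x - s i‖ ≤ Real.sqrt (ψ i) := Real.le_sqrt_of_sq_le hx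
  have htri : ‖s i - s j‖ ≤ ‖x - s i‖ + ‖x - s j‖ := by
    rw [norm_sub_rev x (s i)]
    exact norm_sub_le_norm_sub_add_norm_sub _ _ _
  have hxj : ψ j ≤ ‖x - s j‖ ^ 2 :=
    (Real.sqrt_le_left (norm_nonneg _)).1 (by linarith [hsep i j hj.symm])
  linarith

/-- Under the separation property, each modified Laguerre cell is exactly the closed ball
of radius `√ψ_i` around its seed intersected with `closure D`; in dimension 2, if the
ball is contained in `closure D`, the cell has measure `π ψ_i`. -/
theorem stmt11 {d N : ℕ} (hd : 1 ≤ d)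
    (D : Set (EuclideanSpace ℝ (Fin d)))
    (s : Fin N → EuclideanSpace ℝ (Fin d)) (ψ : Fin N → ℝ)
    (hψ : ∀ i, 0 ≤ ψ i)
    (hsep : ∀ i j : Fin N, i ≠ j → Real.sqrt (ψ i) + Real.sqrt (ψ j) ≤ ‖s i - s j‖) :
    (∀ i, Vcell D s ψ i = Metric.closedBall (s i) (Real.sqrt (ψ i)) ∩ closure D) ∧
    (d = 2 → ∀ i, Metric.closedBall (s i) (Real.sqrt (ψ i)) ⊆ closure D →
      (volume (Vcell D s ψ i)).toReal = Real.pi * ψ i) := by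
  refine ⟨Vcell_eq_closedBall_inter D s ψ hψ hsep, ?_⟩
  rintro rfl i hi
  rw [Vcell_eq_closedBall_inter D s ψ hψ hsep, Set.inter_eq_left.2 hi,
    EuclideanSpace.volume_closedBall_fin_two, ENNReal.toReal_mul, ENNReal.toReal_pow,
    ENNReal.toReal_ofReal (Real.sqrt_nonneg _), Real.sq_sqrt (hψ i), ENNReal.toReal_ofReal Real.pi_nonneg,
    mul_comm]
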